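/- Let C be a symmetric m×m integer matrix and let i ≠ j be two of its indices. Then the motivic generating series of the linked quiver L(ij)C, with the variable of the new index ν specialized to x_ν = x_i·x_j, equals the motivic generating series of C. Explicitly, for every dimension vector d ∈ ℕ^m the following identity holds in the field ℚ(q): Σ_{e=0}^{min(d_i,d_j)} (−q)^{(d^e)ᵀ·(L(ij)C)·(d^e)} / ( (q²;q²)_e · Π_{a=1}^{m} (q²;q²)_{(d^e)_a} ) = (−q)^{dᵀCd} / Π_{a=1}^{m} (q²;q²)_{d_a}, where d^e ∈ ℕ^{m+1} is the dimension vector with (d^e)_a = d_a for a ∉ {i,j}, (d^e)_i = d_i − e, (d^e)_j = d_j − e, and (d^e)_ν = e. -/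

import Mathlib

/-- The variable `q` of the field `ℚ(q)` of rational functions. -/
noncomputable def qvar : RatFunc ℚ := RatFunc.X

/-- The q-Pochhammer symbol `(q²;q²)_n = ∏_{t=0}^{n-1} (1 - q² · q^{2t})` in `ℚ(q)`. -/
noncomputable def qPoch (n : ℕ) : RatFunc ℚ :=
  ∏ t ∈ Finset.range n, (1 - qvar ^ (2 * t + 2))

/-- The quadratic form `dᵀ C d` of an integer matrix `C` on a dimension vector `d`. -/
def qform {ι : Type*} [Fintype ι] (C : ι → ι → ℤ) (d : ι → ℕ) : ℤ :=
  ∑ a : ι, ∑ b : ι, (d a : ℤ) * C a b * (d b : ℤ)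

/-- The linking `L(ij)C` of a symmetric integer matrix `C` at distinct indices
`i, j`, with the new index `ν` modelled by `Sum.inr ()`: the `(i,j)` entry increases by
one and the new row is `C(i,·) + C(j,·)` with the appropriate shifts. -/
def linkQuiver {m : ℕ} (C : Fin m → Fin m → ℤ) (i j : Fin m) :
    (Fin m ⊕ Unit) → (Fin m ⊕ Unit) → ℤ
  | Sum.inl a, Sum.inl b =>
      if (a = i ∧ b = j) ∨ (a = j ∧ b = i) then C a b + 1 else C a b
  | Sum.inl a, Sum.inr _ =>
      if a = i then C i i + C i j
      else if a = j then C j j + C i j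
      else C i a + C j a
  | Sum.inr _, Sum.inl b =>
      if b = i then C i i + C i j
      else if b = j then C j j + C i j
      else C i b + C j b
  | Sum.inr _, Sum.inr _ => C i i + C j j + 2 * C i j

/-- The dimension vector `d^e` on the extended index set: `d` away from `i, j`,
`d_i - e` at `i`, `d_j - e` at `j`, and `e` at the new index. -/
def dvec {m : ℕ} (d : Fin m → ℕ) (i j : Fin m) (e : ℕ) : (Fin m ⊕ Unit) → ℕ
  | Sum.inl a => if a = i then d i - e else if a = j then d j - e else d a
  | Sum.inr _ => e

theorem one_sub_qvar_pow_ne_zero (n : ℕ) (hn : n ≠ 0) : 1 - qvar ^ n ≠ 0 := by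
  intro h
  have hX : (Polynomial.X : Polynomial ℚ) ^ n = 1 := by
    apply RatFunc.algebraMap_injective ℚ
    rw [map_pow, RatFunc.algebraMap_X, map_one]
    exact (sub_eq_zero.mp h).symm
  simpa [hn] using congrArg Polynomial.natDegree hX

theorem qPoch_succ (n : ℕ) : qPoch (n + 1) = qPoch n * (1 - qvar ^ (2 * n + 2)) :=
  Finset.prod_range_succ _ n

theorem qPoch_ne_zero (n : ℕ) : qPoch n ≠ 0 :=
  Finset.prod_ne_zero_iff.mpr fun _ _ => one_sub_qvar_pow_ne_zero _ (by omega)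

/-- The `e`-th summand of the sum in `sum_range_min_pentagon`, extended by zero beyond `min a b`. -/
noncomputable def pentagonTerm (a b e : ℕ) : RatFunc ℚ :=
  if e ≤ a ∧ e ≤ b then
    qvar ^ (2 * ((a - e) * (b - e))) / (qPoch e * qPoch (a - e) * qPoch (b - e))
  else 0

theorem pentagonTerm_zero_succ (a b : ℕ) :
    (1 - qvar ^ (2 * b + 2)) * pentagonTerm a (b + 1) 0 =
      qvar ^ (2 * a) * pentagonTerm a b 0 := by
  have h := one_sub_qvar_pow_ne_zero (2 * b + 2) (by omega)
  have ha := qPoch_ne_zero a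
  have hb := qPoch_ne_zero b
  have h0 := qPoch_ne_zero 0
  simp only [pentagonTerm, Nat.zero_le, and_self, if_true, Nat.sub_zero, qPoch_succ]
  field_simp
  ring

theorem pentagonTerm_succ_succ (a b e : ℕ) :
    (1 - qvar ^ (2 * b + 2)) * pentagonTerm a (b + 1) (e + 1) =
      qvar ^ (2 * (a - (e + 1))) * pentagonTerm a b (e + 1) +
        (1 - qvar ^ (2 * (a - e))) * pentagonTerm a b e := by
  by_cases hea : e + 1 ≤ a
  swap
  · by_cases h : e = a
    · simp [pentagonTerm, h]
    · have : ¬ e ≤ a := by omega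
      simp [pentagonTerm, hea, this]
  by_cases heb : e ≤ b
  swap
  · have : ¬ e + 1 ≤ b := by omega
    simp [pentagonTerm, heb, this]
  obtain ⟨k, rfl⟩ := Nat.exists_eq_add_of_le hea
  obtain ⟨l, rfl⟩ := Nat.exists_eq_add_of_le heb
  have h1 : e + 1 + k - (e + 1) = k := by omega
  have h2 : e + 1 + k - e = k + 1 := by omega
  have h3 : e + l - e = l := by omega
  have h4 : e + l + 1 - (e + 1) = l := by omega
  have he := one_sub_qvar_pow_ne_zero (2 * e + 2) (by omega)
  have hk := one_sub_qvar_pow_ne_zero (2 * k + 2) (by omega)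
  have pe := qPoch_ne_zero e
  have pk := qPoch_ne_zero k
  have pl := qPoch_ne_zero l
  rcases l with _ | l
  · simp only [pentagonTerm, h1, h2, h3, h4, qPoch_succ]
    simp [mul_add, -mul_eq_mul_left_iff, -mul_eq_mul_right_iff, show e ≤ e + 1 + k by omega]
    field_simp
  · have h5 : e + (l + 1) - (e + 1) = l := by omega
    have hl := one_sub_qvar_pow_ne_zero (2 * l + 2) (by omega)
    have pl' := qPoch_ne_zero l
    simp only [pentagonTerm, h1, h2, h3, h4, h5, qPoch_succ]
    rw [if_pos (by omega), if_pos (by omega), if_pos (by omega)]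
    field_simp
    ring

theorem sum_pentagonTerm (a b : ℕ) :
    ∑ e ∈ Finset.range (b + 1), pentagonTerm a b e = 1 / (qPoch a * qPoch b) := by
  induction b with
  | zero => simp [pentagonTerm, qPoch]
  | succ b ih =>
    have h := one_sub_qvar_pow_ne_zero (2 * b + 2) (by omega)
    have hlast : pentagonTerm a b (b + 1) = 0 := by simp [pentagonTerm]
    have key : (1 - qvar ^ (2 * b + 2)) *
        ∑ e ∈ Finset.range (b + 1 + 1), pentagonTerm a (b + 1) e =
        1 / (qPoch a * qPoch b) := by
      rw [Finset.sum_range_succ', mul_add, Finset.mul_sum, pentagonTerm_zero_succ]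
      simp only [pentagonTerm_succ_succ, Finset.sum_add_distrib]
      have hs := Finset.sum_range_succ' (fun e => qvar ^ (2 * (a - e)) * pentagonTerm a b e) (b + 1)
      rw [Finset.sum_range_succ] at hs
      simp only [hlast, mul_zero, add_zero, Nat.sub_zero] at hs
      rw [add_right_comm, ← hs, ← Finset.sum_add_distrib, ← ih]
      exact Finset.sum_congr rfl fun e _ => by ring
    rw [qPoch_succ, ← mul_assoc, ← div_div, ← key, mul_div_cancel_left₀ _ h]

theorem sum_range_min_pentagon (a b : ℕ) :
    ∑ e ∈ Finset.range (min a b + 1),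
      qvar ^ (2 * ((a - e) * (b - e))) / (qPoch e * qPoch (a - e) * qPoch (b - e)) =
      1 / (qPoch a * qPoch b) := by
  rw [← sum_pentagonTerm,
    ← Finset.sum_subset (Finset.range_mono (show min a b + 1 ≤ b + 1 by omega))]
  · refine Finset.sum_congr rfl fun e he => ?_
    rw [Finset.mem_range] at he
    rw [pentagonTerm, if_pos (by omega)]
  · intro e _ he
    rw [Finset.mem_range] at he
    rw [pentagonTerm, if_neg (by omega)]

section Linking

variable {m : ℕ} {i j : Fin m}

theorem linkQuiver_inl_inl (C : Fin m → Fin m → ℤ) (hij : i ≠ j) (a b : Fin m) :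
    linkQuiver C i j (.inl a) (.inl b) =
      C a b + (if a = i then 1 else 0) * (if b = j then 1 else 0) +
        (if a = j then 1 else 0) * (if b = i then 1 else 0) := by
  simp only [linkQuiver]
  grind

theorem linkQuiver_inl_inr (C : Fin m → Fin m → ℤ) (hsym : ∀ a b, C a b = C b a)
    (a : Fin m) (u : Unit) : linkQuiver C i j (.inl a) (.inr u) = C a i + C a j := by
  simp only [linkQuiver]
  grind

theorem linkQuiver_inr_inl (C : Fin m → Fin m → ℤ) (hsym : ∀ a b, C a b = C b a)
    (b : Fin m) (u : Unit) : linkQuiver C i j (.inr u) (.inl b) = C i b + C j b := by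
  simp only [linkQuiver]
  grind

theorem dvec_inl_left (d : Fin m → ℕ) (e : ℕ) : dvec d i j e (.inl i) = d i - e := by
  simp [dvec]

theorem dvec_inl_right (hij : i ≠ j) (d : Fin m → ℕ) (e : ℕ) :
    dvec d i j e (.inl j) = d j - e := by
  simp [dvec, hij.symm]

theorem cast_eq_dvec_add (hij : i ≠ j) (d : Fin m → ℕ) {e : ℕ} (hi : e ≤ d i) (hj : e ≤ d j)
    (a : Fin m) :
    (d a : ℤ) = dvec d i j e (.inl a) + e * (if a = i then 1 else 0) +
      e * (if a = j then 1 else 0) := by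
  simp only [dvec]
  grind

theorem qform_linkQuiver_dvec (C : Fin m → Fin m → ℤ) (hsym : ∀ a b, C a b = C b a)
    (hij : i ≠ j) (d : Fin m → ℕ) {e : ℕ} (hi : e ≤ d i) (hj : e ≤ d j) :
    qform (linkQuiver C i j) (dvec d i j e) =
      qform C d + ((2 * ((d i - e) * (d j - e)) : ℕ) : ℤ) := by
  have hvi := dvec_inl_left (i := i) (j := j) d e
  have hvj := dvec_inl_right hij d e
  have hν : dvec d i j e (.inr ()) = e := rfl
  have hνν : linkQuiver C i j (.inr ()) (.inr ()) = C i i + C j j + 2 * C i j := rfl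
  simp only [qform, Fintype.sum_sum_type, Finset.univ_unique, Finset.sum_singleton,
    PUnit.default_eq_unit, linkQuiver_inl_inl C hij, linkQuiver_inl_inr C hsym,
    linkQuiver_inr_inl C hsym, hν, hνν, cast_eq_dvec_add hij d hi hj]
  have sum_sum_ite (k : Fin m) (f : Fin m → Fin m → ℤ) :
      ∑ x, ∑ y, (if x = k then f x y else 0) = ∑ y, f k y := by
    rw [Finset.sum_comm]
    simp
  push_cast
  rw [← hvi, ← hvj]
  generalize hv : (fun a => (dvec d i j e (.inl a) : ℤ)) = v
  have hv' a : (dvec d i j e (.inl a) : ℤ) = v a := congrFun hv a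
  simp only [hv']
  simp only [mul_add, add_mul, Finset.sum_add_distrib, mul_ite, ite_mul, mul_one,
    mul_zero, zero_mul, Finset.sum_ite_eq', Finset.mem_univ, if_true]
  rw [sum_sum_ite i, sum_sum_ite j, hsym j i]
  ring

theorem prod_eq_mul_mul_prod_erase_erase {M : Type*} [CommMonoid M] (hij : i ≠ j)
    (f : Fin m → M) :
    ∏ a, f a = f i * f j * ∏ a ∈ (Finset.univ.erase i).erase j, f a := by
  rw [mul_assoc, Finset.mul_prod_erase _ _ (by simp [hij.symm]),
    Finset.mul_prod_erase _ _ (Finset.mem_univ i)]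

end Linking

/-- Linking preserves the motivic generating series: for a symmetric `m×m` integer
matrix `C`, distinct indices `i ≠ j`, and every dimension vector `d ∈ ℕ^m`, the
coefficient identity
`∑_{e=0}^{min(d_i,d_j)} (-q)^{(d^e)ᵀ (L(ij)C) (d^e)} / ((q²;q²)_e ∏_a (q²;q²)_{(d^e)_a})
  = (-q)^{dᵀCd} / ∏_a (q²;q²)_{d_a}`
holds in `ℚ(q)` (the new index carrying the specialization `x_ν = x_i x_j`). -/
theorem linking_preserves_motivic_generating_series
    {m : ℕ} (C : Fin m → Fin m → ℤ) (hsym : ∀ a b, C a b = C b a)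
    (i j : Fin m) (hij : i ≠ j) (d : Fin m → ℕ) :
    ∑ e ∈ Finset.range (min (d i) (d j) + 1),
      (-qvar) ^ qform (linkQuiver C i j) (dvec d i j e) /
        (qPoch e * ∏ a : Fin m, qPoch (dvec d i j e (Sum.inl a))) =
    (-qvar) ^ qform C d / ∏ a : Fin m, qPoch (d a) := by
  have hq : (-qvar) ≠ 0 := neg_ne_zero.mpr RatFunc.X_ne_zero
  rw [prod_eq_mul_mul_prod_erase_erase hij (fun a => qPoch (d a)), ← div_div,
    div_eq_mul_one_div _ (_ * _), ← sum_range_min_pentagon, Finset.mul_sum, Finset.sum_div]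
  refine Finset.sum_congr rfl fun e he => ?_
  rw [Finset.mem_range] at he
  have hR : ∏ a ∈ (Finset.univ.erase i).erase j, qPoch (dvec d i j e (.inl a)) =
      ∏ a ∈ (Finset.univ.erase i).erase j, qPoch (d a) :=
    Finset.prod_congr rfl fun a ha => by
      simp only [Finset.mem_erase] at ha
      simp [dvec, ha.1, ha.2.1]
  rw [qform_linkQuiver_dvec C hsym hij d (by omega) (by omega), zpow_add₀ hq, zpow_natCast,
    (even_two_mul _).neg_pow, prod_eq_mul_mul_prod_erase_erase hij, hR, dvec_inl_left,
    dvec_inl_right hij, ← mul_div_assoc, div_div]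
  simp only [mul_assoc]
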